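/- arXiv:math/0209384 — 3 statements merged into one kernel-verified Lean document; each statement's English description precedes it below -/
import Mathlib

section
/- Let m ≥ 2, let Q : (0,∞) → ℝ be a positive non-decreasing function with Q(t) = o(t²) as t → +∞ and liminf_{r→+∞} Q(r)·(log r)/r² < +∞. Suppose u ∈ C²(ℝ^m) satisfies u* := sup_{ℝ^m} u < +∞. Then for every k ≥ 1 there exists a point x_k ∈ ℝ^m with |x_k| > 0 such that u(x_k) > u* − 1/k and Q(|x_k|)·Δu(x_k) < 1/k. -/
open Filter Asymptotics

/-- The Laplacian on Euclidean space: the sum of the pure second partial derivatives. -/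
noncomputable def euclideanLaplacian {m : ℕ} (u : EuclideanSpace ℝ (Fin m) → ℝ)
    (x : EuclideanSpace ℝ (Fin m)) : ℝ :=
  ∑ i, fderiv ℝ (fun y => fderiv ℝ u y (EuclideanSpace.single i 1)) x (EuclideanSpace.single i 1)

theorem deriv_deriv_nonpos_of_isLocalMax {f : ℝ → ℝ} {a : ℝ} (hf : ContinuousAt f a)
    (hmax : IsLocalMax f a) : deriv (deriv f) a ≤ 0 := by
  by_contra! hpos
  have hmin := isLocalMin_of_deriv_deriv_pos hpos hmax.deriv_eq_zero hf
  have heq : f =ᶠ[nhds a] fun _ => f a := by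
    filter_upwards [hmin, hmax] with x h1 h2
    exact le_antisymm h2 h1
  have h0 : deriv (deriv f) a = 0 := by
    rw [heq.deriv.deriv_eq]
    simp
  linarith

theorem continuous_euclideanLaplacian {m : ℕ} {u : EuclideanSpace ℝ (Fin m) → ℝ}
    (hu : ContDiff ℝ 2 u) : Continuous (euclideanLaplacian u) := by
  refine continuous_finsetSum _ fun i _ => ?_
  have h1 : ContDiff ℝ 1 (fderiv ℝ u) := hu.fderiv_right (by norm_num)
  have h2 : ContDiff ℝ 1 fun y => fderiv ℝ u y (EuclideanSpace.single i 1) :=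
    h1.clm_apply contDiff_const
  exact (h2.continuous_fderiv (by norm_num)).clm_apply continuous_const

/-- Where `u - c ‖· - p‖ ^ 2` has a local maximum, the Laplacian of `u` is at most that of
`c ‖· - p‖ ^ 2`, which is `2 m c`. -/
theorem euclideanLaplacian_le_of_isLocalMax {m : ℕ} {u : EuclideanSpace ℝ (Fin m) → ℝ}
    (hu : ContDiff ℝ 2 u) {c : ℝ} {p x : EuclideanSpace ℝ (Fin m)}
    (hmax : IsLocalMax (fun y => u y - c * ‖y - p‖ ^ 2) x) :
    euclideanLaplacian u x ≤ m * (2 * c) := by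
  have key (i : Fin m) : fderiv ℝ (fun y => fderiv ℝ u y (EuclideanSpace.single i 1)) x
      (EuclideanSpace.single i 1) ≤ 2 * c := by
    set e : EuclideanSpace ℝ (Fin m) := EuclideanSpace.single i 1 with he
    have hnorm : ‖e‖ = 1 := by simp [he]
    have hline (t : ℝ) : HasDerivAt (fun s : ℝ => x + s • e) e t := by
      simpa using ((hasDerivAt_id t).smul_const e).const_add x
    have h1 : ContDiff ℝ 1 (fderiv ℝ u) := hu.fderiv_right (by norm_num)
    have h2 : ContDiff ℝ 1 fun y => fderiv ℝ u y e := h1.clm_apply contDiff_const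
    set a : ℝ := inner ℝ (x - p) e
    have hsq (t : ℝ) : ‖x + t • e - p‖ ^ 2 = ‖x - p‖ ^ 2 + 2 * (t * a) + t ^ 2 := by
      rw [show x + t • e - p = (x - p) + t • e by abel, norm_add_sq_real, inner_smul_right,
        norm_smul, hnorm]
      simp [a]
    set h : ℝ → ℝ := fun t => u (x + t • e) - c * ‖x + t • e - p‖ ^ 2 with hh
    have hd (t : ℝ) : HasDerivAt h (fderiv ℝ u (x + t • e) e - c * (2 * a + 2 * t)) t := by
      have hu' := ((hu.differentiable (by norm_num)) (x + t • e)).hasFDerivAt.comp_hasDerivAt t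
        (hline t)
      have hq : HasDerivAt (fun t : ℝ => c * (‖x - p‖ ^ 2 + 2 * (t * a) + t ^ 2))
          (c * (2 * a + 2 * t)) t := by
        have := (((((hasDerivAt_id t).mul_const a).const_mul 2).const_add (‖x - p‖ ^ 2)).add
          ((hasDerivAt_id t).pow 2)).const_mul c
        simpa using this
      simp only [hh, hsq]
      exact hu'.sub hq
    have hderiv : deriv h = fun t => fderiv ℝ u (x + t • e) e - c * (2 * a + 2 * t) :=
      funext fun t => (hd t).deriv
    have hdd : HasDerivAt (deriv h) (fderiv ℝ (fun y => fderiv ℝ u y e) x e - c * 2) 0 := by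
      rw [hderiv]
      have hf := ((h2.differentiable (by norm_num)) (x + (0 : ℝ) • e)).hasFDerivAt.comp_hasDerivAt
        0 (hline 0)
      have hq : HasDerivAt (fun t : ℝ => c * (2 * a + 2 * t)) (c * 2) 0 := by
        simpa using (((hasDerivAt_id (0 : ℝ)).const_mul 2).const_add (2 * a)).const_mul c
      rw [zero_smul, add_zero] at hf
      exact hf.sub hq
    have hloc : IsLocalMax h 0 := by
      have hc : Tendsto (fun s : ℝ => x + s • e) (nhds 0) (nhds x) := by
        simpa using (hline 0).continuousAt.tendsto
      filter_upwards [hc.eventually hmax] with t ht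
      simpa [hh] using ht
    have := deriv_deriv_nonpos_of_isLocalMax (hd 0).continuousAt hloc
    rw [hdd.deriv] at this
    linarith
  calc euclideanLaplacian u x ≤ ∑ _i : Fin m, 2 * c := Finset.sum_le_sum fun i _ => key i
    _ = m * (2 * c) := by simp

theorem stmt2 {m : ℕ} (hm : 2 ≤ m) (Q : ℝ → ℝ)
    (hQpos : ∀ t > (0:ℝ), 0 < Q t)
    (hQmono : ∀ s t : ℝ, 0 < s → s ≤ t → Q s ≤ Q t)
    (hQo : Q =o[atTop] fun t => t ^ 2)
    (hliminf : ∃ C : ℝ, ∃ᶠ r in atTop, Q r * Real.log r / r ^ 2 ≤ C)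
    (u : EuclideanSpace ℝ (Fin m) → ℝ) (hu : ContDiff ℝ 2 u)
    (hbdd : BddAbove (Set.range u)) :
    ∀ k : ℕ, 1 ≤ k → ∃ x : EuclideanSpace ℝ (Fin m), 0 < ‖x‖ ∧
      (⨆ y, u y) - 1 / (k : ℝ) < u x ∧
      Q ‖x‖ * euclideanLaplacian u x < 1 / (k : ℝ) := by
  intro k hk
  have hm0 : (0 : ℝ) < m := by exact_mod_cast (by omega : 0 < m)
  have hε : (0 : ℝ) < 1 / (k : ℝ) := by positivity
  set ε : ℝ := 1 / (k : ℝ)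
  set S : ℝ := ⨆ y, u y
  have hS (y) : u y ≤ S := le_ciSup hbdd y
  obtain ⟨p, hp⟩ : ∃ p, S - ε < u p := exists_lt_of_lt_ciSup (by linarith : S - ε < ⨆ y, u y)
  -- A radius at which `Q R` is so small that the paraboloid below rises by more than `ε`.
  obtain ⟨R, hR0, hRp, hRQ⟩ : ∃ R : ℝ, 0 < R ∧ 2 * ‖p‖ < R ∧ Q R ≤ 1 / (16 * m) * R ^ 2 := by
    have hb := hQo.bound (show (0 : ℝ) < 1 / (16 * m) by positivity)
    obtain ⟨R, h1, h2, h3⟩ :=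
      (hb.and ((eventually_gt_atTop 0).and (eventually_gt_atTop (2 * ‖p‖)))).exists
    refine ⟨R, h2, h3, (le_abs_self _).trans ?_⟩
    simpa using h1
  have hQR : 0 < Q R := hQpos R hR0
  set c : ℝ := ε / (4 * m * Q R) with hc
  have hc0 : 0 < c := by positivity
  have hcR : ε ≤ c * (R / 2) ^ 2 := by
    have h16 : 16 * m * Q R ≤ R ^ 2 := by
      calc 16 * m * Q R ≤ 16 * m * (1 / (16 * m) * R ^ 2) := by gcongr
        _ = R ^ 2 := by field_simp
    rw [hc, div_mul_eq_mul_div, le_div_iff₀ (by positivity)]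
    nlinarith
  set F : EuclideanSpace ℝ (Fin m) → ℝ := fun y => u y - c * ‖y - p‖ ^ 2 with hF
  have hFc : Continuous F := by
    have := hu.continuous
    fun_prop
  have hpR : ‖p‖ < R := by linarith [norm_nonneg p]
  obtain ⟨x₀, hx₀, hmax⟩ := (isCompact_closedBall (0 : EuclideanSpace ℝ (Fin m)) R).exists_isMaxOn
    ⟨p, by simpa using hpR.le⟩ hFc.continuousOn
  have hpx : u p ≤ u x₀ - c * ‖x₀ - p‖ ^ 2 := by
    simpa [hF] using hmax (show p ∈ Metric.closedBall 0 R by simpa using hpR.le)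
  have hx₀R : ‖x₀‖ < R := by
    refine lt_of_le_of_ne (by simpa using hx₀) fun heq => ?_
    have h1 : R / 2 ≤ ‖x₀ - p‖ := by linarith [norm_sub_norm_le x₀ p]
    have h2 : c * (R / 2) ^ 2 ≤ c * ‖x₀ - p‖ ^ 2 := by gcongr
    linarith [hS x₀]
  have hux₀ : S - ε < u x₀ := by
    have : 0 ≤ c * ‖x₀ - p‖ ^ 2 := by positivity
    linarith
  have hΔ : Q R * euclideanLaplacian u x₀ < ε := by
    have hle := euclideanLaplacian_le_of_isLocalMax hu
      (hmax.isLocalMax (Metric.closedBall_mem_nhds_of_mem (by simpa using hx₀R)))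
    calc Q R * euclideanLaplacian u x₀ ≤ Q R * (m * (2 * c)) := by gcongr
      _ = ε / 2 := by rw [hc]; field_simp; norm_num
      _ < ε := by linarith
  -- These are open conditions, so they also hold at some point other than the origin.
  have hev : ∀ᶠ x in nhds x₀, ‖x‖ < R ∧ S - ε < u x ∧ Q R * euclideanLaplacian u x < ε :=
    (continuous_norm.continuousAt.eventually_lt_const hx₀R).and
      ((hu.continuous.continuousAt.eventually_const_lt hux₀).and
        ((continuous_const.mul (continuous_euclideanLaplacian hu)).continuousAt.eventually_lt_const
          hΔ))
  obtain ⟨x, hx0, hxR, hux, hΔx⟩ : ∃ x : EuclideanSpace ℝ (Fin m), x ≠ 0 ∧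
      ‖x‖ < R ∧ S - ε < u x ∧ Q R * euclideanLaplacian u x < ε := by
    have : Nonempty (Fin m) := ⟨⟨0, by omega⟩⟩
    obtain ⟨x, hx0, hx⟩ := (dense_compl_singleton (0 : EuclideanSpace ℝ (Fin m))).inter_nhds_nonempty
      hev
    exact ⟨x, hx0, hx⟩
  have hxpos : 0 < ‖x‖ := norm_pos_iff.mpr hx0
  refine ⟨x, hxpos, hux, ?_⟩
  rcases le_or_gt (euclideanLaplacian u x) 0 with hneg | hpos
  · exact (mul_nonpos_of_nonneg_of_nonpos (hQpos _ hxpos).le hneg).trans_lt hε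
  · exact (mul_le_mul_of_nonneg_right (hQmono _ _ hxpos hxR.le) hpos.le).trans_lt hΔx
end

section
/- Let m ≥ 2 and let φ ∈ C¹((0,∞)) ∩ C⁰([0,∞)) satisfy φ(0) = 0, φ(t) > 0 for all t > 0, and φ(t) ≤ A t^δ for all t ≥ 0, for some positive constants A and δ. Let Q : (0,∞) → ℝ be positive, non-decreasing, with Q(t) = o(t^{1+δ}) as t → +∞ and liminf_{r→+∞} Q(r)·(log r)/r^{1+δ} < +∞. Let b : ℝ^m → ℝ be continuous with b(x) ≥ 1/Q(|x|) for |x| > 0, and let f : ℝ → ℝ be continuous. Suppose u ∈ C¹(ℝ^m) satisfies u* := sup u < +∞, the vector field X : ℝ^m → ℝ^m defined by X(x) = φ(|∇u(x)|)·∇u(x)/|∇u(x)| when ∇u(x) ≠ 0 and X(x) = 0 when ∇u(x) = 0 is of class C¹, and div X (x) ≥ b(x) f(u(x)) for every x in Ω_γ = {x ∈ ℝ^m : u(x) > γ}, for some γ < u*. Then f(u*) ≤ 0. -/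
open Filter Asymptotics Classical

/-- The divergence of a vector field on Euclidean space. -/
noncomputable def euclideanDiv {m : ℕ}
    (X : EuclideanSpace ℝ (Fin m) → EuclideanSpace ℝ (Fin m))
    (x : EuclideanSpace ℝ (Fin m)) : ℝ :=
  ∑ i, fderiv ℝ (fun y => X y i) x (EuclideanSpace.single i 1)

section Divergence

open MeasureTheory

variable {m : ℕ}

theorem euclideanDiv_smul {g : EuclideanSpace ℝ (Fin m) → ℝ}
    {X : EuclideanSpace ℝ (Fin m) → EuclideanSpace ℝ (Fin m)} {x : EuclideanSpace ℝ (Fin m)}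
    (hg : DifferentiableAt ℝ g x) (hX : DifferentiableAt ℝ X x) :
    euclideanDiv (fun y => g y • X y) x = g x * euclideanDiv X x + fderiv ℝ g x (X x) := by
  have hXi : ∀ i, DifferentiableAt ℝ (fun y => X y i) x := differentiableAt_euclidean.1 hX
  have hsum : X x = ∑ i, X x i • EuclideanSpace.single i (1 : ℝ) := by
    simpa using ((EuclideanSpace.basisFun (Fin m) ℝ).sum_repr (X x)).symm
  conv_rhs => rw [hsum]
  simp only [euclideanDiv, map_sum, map_smul, Finset.mul_sum, ← Finset.sum_add_distrib]
  refine Finset.sum_congr rfl fun i _ => ?_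
  simp only [PiLp.smul_apply, smul_eq_mul]
  rw [fderiv_fun_mul hg (hXi i)]
  simp

theorem integrable_fderiv_apply_of_hasCompactSupport {g : EuclideanSpace ℝ (Fin m) → ℝ}
    (hg : ContDiff ℝ 1 g) (hc : HasCompactSupport g) (v : EuclideanSpace ℝ (Fin m)) :
    Integrable fun x => fderiv ℝ g x v :=
  ((hg.continuous_fderiv one_ne_zero).clm_apply continuous_const).integrable_of_hasCompactSupport
    (hc.fderiv_apply ℝ v)

theorem integral_fderiv_apply_eq_zero {g : EuclideanSpace ℝ (Fin m) → ℝ}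
    (hg : ContDiff ℝ 1 g) (hc : HasCompactSupport g) (v : EuclideanSpace ℝ (Fin m)) :
    ∫ x, fderiv ℝ g x v = 0 := by
  have h := integral_mul_fderiv_eq_neg_fderiv_mul_of_integrable (𝕜 := ℝ) (μ := volume)
    (f := fun _ : EuclideanSpace ℝ (Fin m) => (1 : ℝ)) (g := g) (v := v) (by simp)
    (by simpa using integrable_fderiv_apply_of_hasCompactSupport hg hc v)
    (by simpa using hg.continuous.integrable_of_hasCompactSupport hc)
    (fun x _ => by fun_prop) (fun x _ => hg.differentiable one_ne_zero x)
  simpa using h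

theorem integral_euclideanDiv_eq_zero
    {Y : EuclideanSpace ℝ (Fin m) → EuclideanSpace ℝ (Fin m)}
    (hY : ContDiff ℝ 1 Y) (hc : HasCompactSupport Y) :
    Integrable (euclideanDiv Y) ∧ ∫ x, euclideanDiv Y x = 0 := by
  have hYi : ∀ i, ContDiff ℝ 1 fun y => Y y i := contDiff_euclidean.1 hY
  have hci : ∀ i, HasCompactSupport fun y => Y y i := fun i =>
    hc.comp_left (g := fun z : EuclideanSpace ℝ (Fin m) => z i) rfl
  have hint := fun i => integrable_fderiv_apply_of_hasCompactSupport (hYi i) (hci i)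
    (EuclideanSpace.single i 1)
  refine ⟨integrable_finsetSum _ fun i _ => hint i, ?_⟩
  simp only [euclideanDiv]
  rw [integral_finsetSum _ fun i _ => hint i]
  exact Finset.sum_eq_zero fun i _ => integral_fderiv_apply_eq_zero (hYi i) (hci i) _

end Divergence

theorem hasDerivAt_max_zero_sq (t : ℝ) :
    HasDerivAt (fun s : ℝ => max s 0 ^ 2) (2 * max t 0) t := by
  rcases lt_trichotomy t 0 with ht | rfl | ht
  · rw [max_eq_right ht.le, mul_zero]
    refine (hasDerivAt_const t (0 : ℝ)).congr_of_eventuallyEq ?_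
    filter_upwards [Iio_mem_nhds ht] with s hs
    simp [max_eq_right (Set.mem_Iio.1 hs).le]
  · have h : (fun s : ℝ => max s 0 ^ 2) =O[nhds 0] fun s => ‖s - 0‖ ^ 2 := by
      refine IsBigO.of_bound 1 (Eventually.of_forall fun s => ?_)
      rcases le_total s 0 with hs | hs <;> simp [hs, sq_nonneg]
    simpa using (h.hasFDerivAt (𝕜 := ℝ) one_lt_two).hasDerivAt
  · rw [max_eq_left ht.le]
    have h : HasDerivAt (fun s : ℝ => s ^ 2) (2 * t) t := by simpa using hasDerivAt_pow 2 t
    refine h.congr_of_eventuallyEq ?_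
    filter_upwards [Ioi_mem_nhds ht] with s hs
    simp [max_eq_left (Set.mem_Ioi.1 hs).le]

theorem contDiff_max_zero_sq : ContDiff ℝ 1 fun s : ℝ => max s 0 ^ 2 := by
  rw [contDiff_one_iff_deriv]
  refine ⟨fun t => (hasDerivAt_max_zero_sq t).differentiableAt, ?_⟩
  rw [funext fun t => (hasDerivAt_max_zero_sq t).deriv]
  fun_prop

/-- A cutoff equal to one on the ball of radius `R`, vanishing off the ball of radius `2 * R`, with
derivative of size `R⁻¹`. -/
theorem exists_cutoff (m : ℕ) : ∃ K > (0 : ℝ), ∀ R > (0 : ℝ),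
    ∃ ψ : EuclideanSpace ℝ (Fin m) → ℝ, ContDiff ℝ 1 ψ ∧ HasCompactSupport ψ ∧
      (∀ x, 0 ≤ ψ x) ∧ (∀ x, ψ x ≤ 1) ∧ (∀ x, ‖x‖ ≤ R → ψ x = 1) ∧
      (∀ x, 2 * R < ‖x‖ → ψ x = 0) ∧ ∀ x, ‖fderiv ℝ ψ x‖ ≤ K / R := by
  let β : ContDiffBump (0 : EuclideanSpace ℝ (Fin m)) := ⟨1, 2, one_pos, one_lt_two⟩
  have hβ : ContDiff ℝ 1 β := β.contDiff
  obtain ⟨K, hK⟩ := (hβ.continuous_fderiv one_ne_zero).bounded_above_of_compact_support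
    (β.hasCompactSupport.fderiv ℝ)
  refine ⟨max K 1, by positivity, fun R hR => ⟨fun x => β (R⁻¹ • x), ?_, ?_, fun x => β.nonneg,
    fun x => β.le_one, fun x hx => ?_, fun x hx => ?_, fun x => ?_⟩⟩
  · exact hβ.comp (contDiff_const_smul _)
  · exact β.hasCompactSupport.comp_smul (inv_ne_zero hR.ne')
  · refine β.one_of_mem_closedBall ?_
    rw [mem_closedBall_zero_iff, norm_smul, norm_inv, Real.norm_of_nonneg hR.le,
      inv_mul_le_iff₀ hR]
    simpa [β] using hx
  · refine β.zero_of_le_dist ?_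
    rw [dist_zero_right, norm_smul, norm_inv, Real.norm_of_nonneg hR.le, le_inv_mul_iff₀ hR]
    simpa [β, mul_comm] using hx.le
  · rw [fderiv_comp_smul, norm_smul, norm_inv, Real.norm_of_nonneg hR.le, div_eq_inv_mul]
    exact mul_le_mul_of_nonneg_left ((hK _).trans (le_max_left _ _)) (inv_nonneg.2 hR.le)

theorem cutoff_error_le {A δ v η ψ d p s : ℝ} {n : ℕ} (hA : 0 < A) (hδ : 0 < δ) (hn : 1 ≤ n)
    (hnδ : δ ≤ n) (hv : 0 ≤ v) (hvη : v ≤ η) (hψ : 0 ≤ ψ) (hψ1 : ψ ≤ 1) (hd : 0 ≤ d)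
    (hp : 0 ≤ p) (hs : 0 ≤ s) (hpA : p ≤ A * s ^ δ) :
    v ^ 2 * ((n + 1) * ψ ^ n * d * p) ≤
      2 * v * ψ ^ (n + 1) * (p * s) + v ^ 2 * (A * (η * (n + 1)) ^ δ * (n + 1) * (d * d ^ δ)) := by
  have hη : 0 ≤ η := hv.trans hvη
  rcases le_total (v * (n + 1) * d) (2 * ψ * s) with h | h
  · have h1 : v ^ 2 * ((n + 1) * ψ ^ n * d * p) ≤ 2 * v * ψ ^ (n + 1) * (p * s) := by
      have := mul_le_mul_of_nonneg_left h (by positivity : 0 ≤ v * ψ ^ n * p)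
      calc _ = v * ψ ^ n * p * (v * (n + 1) * d) := by ring
        _ ≤ _ := this
        _ = _ := by ring
    have h2 : 0 ≤ v ^ 2 * (A * (η * (n + 1)) ^ δ * (n + 1) * (d * d ^ δ)) := by positivity
    linarith
  · have h1 : ψ ^ n * p ≤ A * (η * (n + 1)) ^ δ * d ^ δ := by
      have hψn : ψ ^ n ≤ ψ ^ δ := by
        rw [← Real.rpow_natCast]
        exact Real.rpow_le_rpow_of_exponent_ge' hψ hψ1 hδ.le hnδ
      have h3 : ψ * s ≤ η * (n + 1) * d := by
        have : v * (n + 1) * d ≤ η * (n + 1) * d := by gcongr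
        have : 0 ≤ ψ * s := by positivity
        linarith
      calc ψ ^ n * p ≤ ψ ^ δ * (A * s ^ δ) := by gcongr
        _ = A * (ψ * s) ^ δ := by rw [Real.mul_rpow hψ hs]; ring
        _ ≤ A * (η * (n + 1) * d) ^ δ := by gcongr
        _ = _ := by rw [Real.mul_rpow (by positivity) hd]; ring
    have h2 := mul_le_mul_of_nonneg_left h1 (by positivity : 0 ≤ v ^ 2 * (n + 1) * d)
    have h3 : 0 ≤ 2 * v * ψ ^ (n + 1) * (p * s) := by positivity
    calc _ = v ^ 2 * (n + 1) * d * (ψ ^ n * p) := by ring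
      _ ≤ _ := h2
      _ ≤ _ := by linarith [h3]

section Growth

open MeasureTheory

variable {m : ℕ}

/-- A Caccioppoli-type inequality for a field `X` parallel to the gradient of `u`. -/
theorem exists_setIntegral_le {u : EuclideanSpace ℝ (Fin m) → ℝ}
    {X : EuclideanSpace ℝ (Fin m) → EuclideanSpace ℝ (Fin m)} {A δ γ η : ℝ} (hA : 0 < A)
    (hδ : 0 < δ) (hη : 0 < η) (hu : ContDiff ℝ 1 u) (hX : ContDiff ℝ 1 X)
    (hXA : ∀ x, ‖X x‖ ≤ A * ‖fderiv ℝ u x‖ ^ δ)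
    (hXu : ∀ x, fderiv ℝ u x (X x) = ‖X x‖ * ‖fderiv ℝ u x‖)
    (huη : ∀ x, u x - γ ≤ η) (hdiv : ∀ x, γ < u x → 0 ≤ euclideanDiv X x) :
    ∃ C > (0 : ℝ), ∀ R > (0 : ℝ), ∀ k : ℝ,
      (∀ x, ‖x‖ ≤ R → γ < u x → k ≤ euclideanDiv X x) →
      k * ∫ x in Metric.closedBall 0 R, max (u x - γ) 0 ^ 2 ≤
        C / R ^ (1 + δ) * ∫ x in Metric.closedBall 0 (2 * R), max (u x - γ) 0 ^ 2 := by
  obtain ⟨K, hK, hcut⟩ := exists_cutoff m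
  obtain ⟨n, hn⟩ := exists_nat_ge (max δ 1)
  have hnδ : δ ≤ n := (le_max_left _ _).trans hn
  have hn1 : 1 ≤ n := by exact_mod_cast (le_max_right _ _).trans hn
  refine ⟨A * (η * (n + 1)) ^ δ * (n + 1) * (K * K ^ δ), by positivity, fun R hR k hk => ?_⟩
  obtain ⟨ψ, hψ, hψc, hψ0, hψ1, hψR, hψ2R, hψd⟩ := hcut R hR
  set C := A * (η * (n + 1)) ^ δ * (n + 1) * (K * K ^ δ) with hC
  have hCR : A * (η * (n + 1)) ^ δ * (n + 1) * (K / R * (K / R) ^ δ) = C / R ^ (1 + δ) := by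
    rw [Real.div_rpow hK.le hR.le, Real.rpow_add hR, Real.rpow_one, hC]
    field_simp
  set w : EuclideanSpace ℝ (Fin m) → ℝ := fun x => max (u x - γ) 0 ^ 2 with hw
  have hwdiff : ContDiff ℝ 1 w := contDiff_max_zero_sq.comp (hu.sub contDiff_const)
  have hw' : ∀ x, HasFDerivAt w ((2 * max (u x - γ) 0) • fderiv ℝ u x) x := fun x =>
    HasDerivAt.comp_hasFDerivAt (h₂ := fun t : ℝ => max t 0 ^ 2) x
      (hasDerivAt_max_zero_sq (u x - γ)) ((hu.differentiable one_ne_zero x).hasFDerivAt.sub_const γ)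
  have hψ' : ∀ x, HasFDerivAt (fun y => ψ y ^ (n + 1))
      (((n + 1 : ℝ) * ψ x ^ n) • fderiv ℝ ψ x) x := fun x => by
    simpa using (hψ.differentiable one_ne_zero x).hasFDerivAt.pow (n + 1)
  set g : EuclideanSpace ℝ (Fin m) → ℝ := fun x => ψ x ^ (n + 1) * w x with hg
  have hgdiff : ContDiff ℝ 1 g := (hψ.pow _).mul hwdiff
  have hgc : HasCompactSupport g :=
    (hψc.comp_left (g := fun t : ℝ => t ^ (n + 1)) (by simp)).mul_right
  obtain ⟨hint, hzero⟩ := integral_euclideanDiv_eq_zero (Y := fun x => g x • X x)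
    (hgdiff.smul hX) hgc.smul_right
  have hpt : ∀ x, (Metric.closedBall 0 R).indicator (fun x => k * w x) x -
      (Metric.closedBall 0 (2 * R)).indicator (fun x => C / R ^ (1 + δ) * w x) x ≤
      euclideanDiv (fun x => g x • X x) x := fun x => by
    rw [euclideanDiv_smul (hgdiff.differentiable one_ne_zero x) (hX.differentiable one_ne_zero x),
      ((hψ' x).fun_mul (hw' x)).fderiv]
    simp only [_root_.add_apply, _root_.smul_apply, smul_eq_mul, hXu]
    have hw0 : 0 ≤ w x := sq_nonneg _
    have hCR0 : 0 ≤ C / R ^ (1 + δ) := by positivity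
    have hmain : (Metric.closedBall 0 R).indicator (fun x => k * w x) x ≤
        g x * euclideanDiv X x := by
      rcases le_or_gt (u x) γ with hux | hux
      · have : w x = 0 := by simp [hw, hux]
        simp [hg, this, Set.indicator]
      · by_cases hx : ‖x‖ ≤ R
        · rw [Set.indicator_of_mem (by simpa using hx)]
          simp only [hg, hψR x hx, one_pow, one_mul]
          rw [mul_comm]
          exact mul_le_mul_of_nonneg_left (hk x hx hux) hw0
        · rw [Set.indicator_of_notMem (by simpa using hx)]
          exact mul_nonneg (mul_nonneg (pow_nonneg (hψ0 x) _) hw0) (hdiv x hux)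
    have herr : -(Metric.closedBall 0 (2 * R)).indicator (fun x => C / R ^ (1 + δ) * w x) x ≤
        ψ x ^ (n + 1) * (2 * max (u x - γ) 0 * (‖X x‖ * ‖fderiv ℝ u x‖)) +
          w x * ((n + 1) * ψ x ^ n * fderiv ℝ ψ x (X x)) := by
      by_cases hx : ‖x‖ ≤ 2 * R
      · rw [Set.indicator_of_mem (by simpa using hx)]
        have h1 := cutoff_error_le (n := n) hA hδ hn1 hnδ (le_max_right (u x - γ) 0)
          (max_le (huη x) hη.le) (hψ0 x) (hψ1 x) (by positivity : 0 ≤ K / R)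
          (norm_nonneg (X x)) (norm_nonneg (fderiv ℝ u x)) (hXA x)
        rw [hCR] at h1
        have h2 : -(K / R * ‖X x‖) ≤ fderiv ℝ ψ x (X x) := by
          refine neg_le_of_abs_le (((fderiv ℝ ψ x).le_opNorm _).trans ?_)
          exact mul_le_mul_of_nonneg_right (hψd x) (norm_nonneg _)
        have h3 := mul_le_mul_of_nonneg_left h2
          (by have := hψ0 x; positivity : 0 ≤ w x * ((n + 1) * ψ x ^ n))
        simp only [hw] at h3 ⊢
        linarith
      · rw [Set.indicator_of_notMem (by simpa using hx), hψ2R x (not_le.1 hx)]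
        simp [Nat.one_le_iff_ne_zero.1 hn1]
    linarith
  have hwint : ∀ r, IntegrableOn w (Metric.closedBall 0 r) := fun r =>
    hwdiff.continuous.continuousOn.integrableOn_compact (isCompact_closedBall 0 r)
  have hind : ∀ c r, Integrable ((Metric.closedBall 0 r).indicator fun x => c * w x) := fun c r =>
    (integrable_indicator_iff measurableSet_closedBall).2 ((hwint r).const_mul c)
  have hle := integral_mono ((hind k R).sub (hind (C / R ^ (1 + δ)) (2 * R))) hint hpt
  rw [hzero, integral_sub' (hind _ _) (hind _ _), integral_indicator measurableSet_closedBall,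
    integral_indicator measurableSet_closedBall, integral_const_mul, integral_const_mul] at hle
  linarith

end Growth

theorem not_pos_of_doubling_growth {G : ℝ → ℝ} {m : ℕ} {M R₀ : ℝ} (hR₀ : 0 < R₀)
    (hGM : ∀ R > 0, G R ≤ M * R ^ m)
    (hdouble : ∀ R ≥ R₀, 2 ^ (m + 1) * G R ≤ G (2 * R)) : ¬ 0 < G R₀ := by
  intro hpos
  have hiter : ∀ j : ℕ, (2 ^ (m + 1)) ^ j * G R₀ ≤ G (2 ^ j * R₀) := by
    intro j
    induction j with
    | zero => simp
    | succ j ih =>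
      have h1 := hdouble (2 ^ j * R₀) (le_mul_of_one_le_left hR₀.le (one_le_pow₀ one_le_two))
      have h2 := mul_le_mul_of_nonneg_left ih (by positivity : (0 : ℝ) ≤ 2 ^ (m + 1))
      calc _ = 2 ^ (m + 1) * ((2 ^ (m + 1)) ^ j * G R₀) := by ring
        _ ≤ _ := h2
        _ ≤ _ := h1
        _ = _ := by ring_nf
  have hbound : ∀ j : ℕ, 2 ^ j * G R₀ ≤ M * R₀ ^ m := fun j => by
    have h := (hiter j).trans (hGM _ (by positivity))
    refine le_of_mul_le_mul_left ?_ (by positivity : (0 : ℝ) < (2 ^ j) ^ m)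
    calc _ = (2 ^ (m + 1)) ^ j * G R₀ := by rw [← pow_mul, ← pow_mul]; ring
      _ ≤ _ := h
      _ = _ := by ring
  obtain ⟨j, hj⟩ := pow_unbounded_of_one_lt (M * R₀ ^ m / G R₀) one_lt_two
  rw [div_lt_iff₀ hpos] at hj
  exact absurd (hbound j) (not_le.2 hj)

open MeasureTheory in
theorem stmt3 {m : ℕ} (hm : 2 ≤ m)
    (φ : ℝ → ℝ) (A δ : ℝ) (hA : 0 < A) (hδ : 0 < δ)
    (hφC0 : ContinuousOn φ (Set.Ici 0)) (hφC1 : ContDiffOn ℝ 1 φ (Set.Ioi 0))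
    (hφ0 : φ 0 = 0) (hφpos : ∀ t > (0:ℝ), 0 < φ t)
    (hφA : ∀ t ≥ (0:ℝ), φ t ≤ A * t ^ δ)
    (Q : ℝ → ℝ)
    (hQpos : ∀ t > (0:ℝ), 0 < Q t)
    (hQmono : ∀ s t : ℝ, 0 < s → s ≤ t → Q s ≤ Q t)
    (hQo : Q =o[atTop] fun t => t ^ (1 + δ))
    (hliminf : ∃ C : ℝ, ∃ᶠ r in atTop, Q r * Real.log r / r ^ (1 + δ) ≤ C)
    (b : EuclideanSpace ℝ (Fin m) → ℝ) (hb : Continuous b)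
    (hbQ : ∀ x : EuclideanSpace ℝ (Fin m), 0 < ‖x‖ → 1 / Q ‖x‖ ≤ b x)
    (f : ℝ → ℝ) (hf : Continuous f)
    (u : EuclideanSpace ℝ (Fin m) → ℝ) (hu : ContDiff ℝ 1 u)
    (hbdd : BddAbove (Set.range u))
    (X : EuclideanSpace ℝ (Fin m) → EuclideanSpace ℝ (Fin m))
    (hXdef : ∀ x, X x = if gradient u x = 0 then 0 else
      (φ ‖gradient u x‖ / ‖gradient u x‖) • gradient u x)
    (hXC1 : ContDiff ℝ 1 X)
    (γ : ℝ) (hγ : γ < ⨆ x, u x)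
    (hineq : ∀ x : EuclideanSpace ℝ (Fin m), γ < u x →
      b x * f (u x) ≤ euclideanDiv X x) :
    f (⨆ x, u x) ≤ 0 := by
  by_contra! hfpos
  set s := ⨆ x, u x with hs
  have hus : ∀ x, u x ≤ s := fun x => le_ciSup hbdd x
  have : Nontrivial (EuclideanSpace ℝ (Fin m)) := by
    have : Nonempty (Fin m) := ⟨⟨0, by omega⟩⟩
    infer_instance
  obtain ⟨ε, hε, hfε⟩ : ∃ ε > 0, ∀ t, s - ε < t → t ≤ s → f s / 2 ≤ f t := by
    have h := hf.continuousAt.eventually (lt_mem_nhds (half_lt_self hfpos))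
    obtain ⟨ε, hε, h⟩ := Metric.eventually_nhds_iff.1 h
    refine ⟨ε, hε, fun t ht hts => (h ?_).le⟩
    rw [Real.dist_eq, abs_lt]
    constructor <;> linarith
  set γ' := max γ (s - ε) with hγ'
  have hγ's : γ' < s := max_lt hγ (by linarith)
  have hc : 0 < f s / 2 := by positivity
  have hbQ' : ∀ R > 0, ∀ x, ‖x‖ ≤ R → 1 / Q R ≤ b x := by
    intro R hR x hx
    rcases eq_or_ne x 0 with rfl | hx0
    · have hlim : Tendsto b (nhdsWithin 0 {0}ᶜ) (nhds (b 0)) :=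
        hb.continuousAt.tendsto.mono_left nhdsWithin_le_nhds
      refine ge_of_tendsto hlim ?_
      filter_upwards [self_mem_nhdsWithin,
        nhdsWithin_le_nhds (Metric.ball_mem_nhds 0 hR)] with y hy hyR
      have hy0 : 0 < ‖y‖ := norm_pos_iff.2 hy
      exact (one_div_le_one_div_of_le (hQpos _ hy0)
        (hQmono _ _ hy0 (mem_ball_zero_iff.1 hyR).le)).trans (hbQ y hy0)
    · have hx0 : 0 < ‖x‖ := norm_pos_iff.2 hx0
      exact (one_div_le_one_div_of_le (hQpos _ hx0) (hQmono _ _ hx0 hx)).trans (hbQ x hx0)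
  have hdivQ : ∀ R > 0, ∀ x, ‖x‖ ≤ R → γ' < u x → f s / 2 / Q R ≤ euclideanDiv X x := by
    intro R hR x hx hux
    refine le_trans ?_ (hineq x ((le_max_left _ _).trans_lt hux))
    rw [div_eq_mul_one_div, mul_comm]
    exact mul_le_mul (hbQ' R hR x hx) (hfε _ ((le_max_right _ _).trans_lt hux) (hus x)) hc.le
      ((one_div_pos.2 (hQpos R hR)).le.trans (hbQ' R hR x hx))
  have hgrad : ∀ x, ‖gradient u x‖ = ‖fderiv ℝ u x‖ := fun x =>
    (InnerProductSpace.toDual ℝ _).symm.norm_map _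
  have hXnorm : ∀ x, ‖X x‖ = φ ‖fderiv ℝ u x‖ := by
    intro x
    rw [hXdef, ← hgrad]
    split_ifs with h
    · simp [h, hφ0]
    · have h0 := norm_pos_iff.2 h
      rw [norm_smul, norm_div, norm_norm, div_mul_cancel₀ _ h0.ne',
        Real.norm_of_nonneg (hφpos _ h0).le]
  have hXu : ∀ x, fderiv ℝ u x (X x) = ‖X x‖ * ‖fderiv ℝ u x‖ := by
    intro x
    rw [hXnorm, ← hgrad, ← toDual_gradient, InnerProductSpace.toDual_apply_apply, hXdef]
    split_ifs with h
    · simp [h]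
    · have h0 := norm_pos_iff.2 h
      rw [inner_smul_right, real_inner_self_eq_norm_sq]
      field_simp
  obtain ⟨C, hC, hG⟩ := exists_setIntegral_le (γ := γ') (η := s - γ') hA hδ (by linarith) hu hXC1
    (fun x => (hXnorm x).trans_le (hφA _ (norm_nonneg _))) hXu
    (fun x => sub_le_sub_right (hus x) _)
    (fun x hx => le_trans
      (div_nonneg hc.le (hQpos (‖x‖ + 1) (by positivity)).le)
      (hdivQ (‖x‖ + 1) (by positivity) x (by linarith) hx))
  set w : EuclideanSpace ℝ (Fin m) → ℝ := fun x => max (u x - γ') 0 ^ 2 with hw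
  have hwc : Continuous w := by have := hu.continuous; fun_prop
  have hw0 : ∀ x, 0 ≤ w x := fun x => sq_nonneg _
  set G : ℝ → ℝ := fun R => ∫ x in Metric.closedBall 0 R, w x with hGdef
  have hG0 : ∀ R, 0 ≤ G R := fun R => integral_nonneg hw0
  have hGM : ∀ R > 0, G R ≤ (s - γ') ^ 2 *
      volume.real (Metric.closedBall (0 : EuclideanSpace ℝ (Fin m)) 1) * R ^ m := by
    intro R hR
    have h := norm_setIntegral_le_of_norm_le_const (μ := volume) (f := w)
      (C := (s - γ') ^ 2) (s := Metric.closedBall 0 R) measure_closedBall_lt_top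
      (fun x _ => by
        rw [Real.norm_of_nonneg (hw0 x)]
        exact pow_le_pow_left₀ (le_max_right _ _)
          (max_le (sub_le_sub_right (hus x) _) (by linarith)) 2)
    have hvol : volume.real (Metric.closedBall (0 : EuclideanSpace ℝ (Fin m)) R) =
        R ^ m * volume.real (Metric.closedBall (0 : EuclideanSpace ℝ (Fin m)) 1) := by
      rw [Measure.addHaar_real_closedBall' _ _ hR.le, finrank_euclideanSpace_fin]
    rw [hvol] at h
    calc G R ≤ ‖G R‖ := le_abs_self _
      _ ≤ _ := h
      _ = _ := by ring
  obtain ⟨x₀, hx₀⟩ := exists_lt_of_lt_ciSup hγ's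
  have hGpos : ∀ R, ‖x₀‖ < R → 0 < G R := by
    intro R hR
    have hint : IntegrableOn w (Metric.closedBall 0 R) :=
      hwc.continuousOn.integrableOn_compact (isCompact_closedBall 0 R)
    refine (setIntegral_pos_iff_support_of_nonneg_ae
      (Eventually.of_forall hw0) hint).2 ?_
    have hopen : IsOpen (Function.support w ∩ Metric.ball 0 R) :=
      (hwc.isOpen_support).inter Metric.isOpen_ball
    refine (hopen.measure_pos volume ⟨x₀, ?_, by simpa using hR⟩).trans_le
      (measure_mono (Set.inter_subset_inter_right _ Metric.ball_subset_closedBall))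
    rw [Function.mem_support, hw]
    exact (pow_pos (lt_max_of_lt_left (sub_pos.2 hx₀)) 2).ne'
  have hκ : 0 < f s / 2 / (C * 2 ^ (m + 1)) := by positivity
  obtain ⟨R₁, hR₁⟩ := eventually_atTop.1 (hQo.bound hκ)
  refine not_pos_of_doubling_growth (R₀ := max R₁ (‖x₀‖ + 1)) (by positivity) hGM ?_
    (hGpos _ (lt_max_of_lt_right (by linarith)))
  intro R hR
  have hR0 : 0 < R := lt_of_lt_of_le (by positivity) hR
  have hRp : 0 < R ^ (1 + δ) := Real.rpow_pos_of_pos hR0 _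
  have hQR := hR₁ R ((le_max_left _ _).trans hR)
  rw [Real.norm_of_nonneg (hQpos R hR0).le, Real.norm_of_nonneg hRp.le] at hQR
  have hkey := hG R hR0 _ (hdivQ R hR0)
  have hQ0 := hQpos R hR0
  have hratio : C * 2 ^ (m + 1) / R ^ (1 + δ) ≤ f s / 2 / Q R := by
    rw [div_le_div_iff₀ hRp hQ0]
    calc _ ≤ C * 2 ^ (m + 1) * (f s / 2 / (C * 2 ^ (m + 1)) * R ^ (1 + δ)) := by gcongr
      _ = _ := by field_simp
  have h := (mul_le_mul_of_nonneg_right hratio (hG0 R)).trans hkey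
  refine le_of_mul_le_mul_left ?_ (by positivity : 0 < C / R ^ (1 + δ))
  calc _ = C * 2 ^ (m + 1) / R ^ (1 + δ) * G R := by ring
    _ ≤ _ := h
end

section
/- Let m ≥ 2, p ≥ 2, σ > p − 1 with σ > 1, H > 0, and let Q : (0,∞) → ℝ be a positive non-decreasing function with Q(t) = o(t^p) as t → +∞ and liminf_{r→+∞} Q(r)·(log r)/r^p < +∞. Let a, b : ℝ^m → ℝ be continuous with b(x) ≥ 1/Q(|x|) for |x| > 0, a_-(x) = max(−a(x), 0) bounded on ℝ^m, and a_-(x)/b(x) ≤ H on ℝ^m. If u ∈ C²(ℝ^m) is a non-negative function satisfying div(|∇u|^{p-2}∇u)(x) ≥ b(x) u(x)^σ + a(x) u(x) for all x ∈ ℝ^m, then u(x) ≤ H^{1/(σ−1)} for all x ∈ ℝ^m. -/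
open Filter Asymptotics Classical

/-- The p-Laplacian on Euclidean space: the divergence of the vector field
`|∇u|^(p-2) ∇u`, extended by `0` at critical points of `u`. -/
noncomputable def pLaplacian {m : ℕ} (p : ℝ) (u : EuclideanSpace ℝ (Fin m) → ℝ)
    (x : EuclideanSpace ℝ (Fin m)) : ℝ :=
  euclideanDiv (fun y => if gradient u y = 0 then 0 else
    ‖gradient u y‖ ^ (p - 2) • gradient u y) x

theorem hasFDerivAt_norm_rpow_smul {E : Type*} [NormedAddCommGroup E] [InnerProductSpace ℝ E]
    {q : ℝ} (hq : 0 ≤ q) (w : E) :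
    HasFDerivAt (fun y : E => ‖y‖ ^ q • y)
      (‖w‖ ^ q • ContinuousLinearMap.id ℝ E
        + ((q * ‖w‖ ^ (q - 2)) • innerSL ℝ w).smulRight w) w := by
  rcases eq_or_ne w 0 with rfl | hw
  · rcases hq.eq_or_lt with rfl | hq
    · have h := hasFDerivAt_id (𝕜 := ℝ) (0 : E)
      simpa [Function.id_def] using h
    · have h0 : (‖(0 : E)‖ ^ q • ContinuousLinearMap.id ℝ E
        + ((q * ‖(0 : E)‖ ^ (q - 2)) • innerSL ℝ (0 : E)).smulRight (0 : E)) = 0 := by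
        ext y; simp [Real.zero_rpow hq.ne']
      rw [h0, hasFDerivAt_iff_isLittleO_nhds_zero]
      simp only [zero_add, norm_zero, smul_zero, sub_zero, zero_apply]
      have h1 : (fun y : E => ‖y‖ ^ q) =o[nhds 0] (fun _ => (1 : ℝ)) := by
        rw [isLittleO_one_iff ℝ]
        have : ContinuousAt (fun y : E => ‖y‖ ^ q) 0 :=
          continuous_norm.continuousAt.rpow_const (Or.inr hq.le)
        simpa [ContinuousAt, Real.zero_rpow hq.ne'] using this
      simpa using h1.smul_isBigO (isBigO_refl (fun y : E => y) (nhds 0))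
  · have hw' : 0 < ‖w‖ := norm_pos_iff.2 hw
    have hsq : ∀ y : E, (‖y‖ ^ 2) ^ (q / 2) = ‖y‖ ^ q := fun y => by
      rw [← Real.rpow_natCast, ← Real.rpow_mul (norm_nonneg y)]
      congr 1; push_cast; ring
    have h1 := ((hasFDerivAt_id w).norm_sq.rpow_const (p := q / 2)
      (Or.inl (pow_ne_zero 2 hw'.ne'))).smul (hasFDerivAt_id w)
    simp only [id, hsq] at h1
    have h2 : (‖w‖ ^ 2) ^ (q / 2 - 1) = ‖w‖ ^ (q - 2) := by
      rw [← Real.rpow_natCast, ← Real.rpow_mul (norm_nonneg w)]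
      congr 1; push_cast; ring
    rw [h2] at h1
    refine HasFDerivAt.congr_fderiv h1 ?_
    ext y
    simp only [add_apply, ContinuousLinearMap.smulRight_apply, smul_apply,
      ContinuousLinearMap.comp_apply, ContinuousLinearMap.id_apply, smul_eq_mul, nsmul_eq_mul]
    congr 2
    push_cast
    ring

theorem IsLocalMax.second_derivative_nonpos {φ φ' : ℝ → ℝ} {c x : ℝ} (hmax : IsLocalMax φ x)
    (hφ : ∀ᶠ t in nhds x, HasDerivAt φ (φ' t) t) (hφ' : HasDerivAt φ' c x) : c ≤ 0 := by
  by_contra! hc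
  have hx : φ' x = 0 := hmax.hasDerivAt_eq_zero hφ.self_of_nhds
  let ψ : ℝ → ℝ := fun t => φ t - c / 4 * (t - x) ^ 2
  have hψ : ∀ᶠ t in nhds x, HasDerivAt ψ (φ' t - c / 2 * (t - x)) t := by
    filter_upwards [hφ] with t ht
    have h := ht.sub ((((hasDerivAt_id t).sub_const x).pow 2).const_mul (c / 4))
    refine h.congr_deriv ?_
    push_cast; simp only [id_eq]; ring
  have hd : deriv ψ =ᶠ[nhds x] fun t => φ' t - c / 2 * (t - x) := by
    filter_upwards [hψ] with t ht using ht.deriv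
  have hd2 : deriv (deriv ψ) x = c / 2 := by
    rw [hd.deriv_eq]
    have h := hφ'.sub (((hasDerivAt_id x).sub_const x).const_mul (c / 2))
    refine (h.congr_deriv ?_).deriv
    ring
  have hmin : IsLocalMin ψ x := isLocalMin_of_deriv_deriv_pos (by rw [hd2]; positivity)
    (by rw [hd.self_of_nhds]; simp [hx]) hψ.self_of_nhds.continuousAt
  obtain ⟨t, ⟨h1, h2⟩, h3⟩ := ((hmin.and hmax).filter_mono nhdsWithin_le_nhds |>.and
    (self_mem_nhdsWithin : _ ∈ nhdsWithin x {x}ᶜ)).exists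
  have h4 : 0 < (t - x) ^ 2 := by
    have := sub_ne_zero.2 h3
    positivity
  simp only [ψ, sub_self] at h1
  nlinarith [mul_pos hc h4]

theorem pLaplacian_eq {m : ℕ} {p : ℝ} (hp : 2 ≤ p) {u : EuclideanSpace ℝ (Fin m) → ℝ}
    {z : EuclideanSpace ℝ (Fin m)}
    {A : EuclideanSpace ℝ (Fin m) →L[ℝ] EuclideanSpace ℝ (Fin m)}
    (hA : HasFDerivAt (gradient u) A z) :
    pLaplacian p u z =
      ‖gradient u z‖ ^ (p - 2) *
          ∑ i, inner ℝ (A (EuclideanSpace.single i 1)) (EuclideanSpace.single i 1)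
        + (p - 2) * ‖gradient u z‖ ^ (p - 2 - 2) *
          inner ℝ (A (gradient u z)) (gradient u z) := by
  set g := gradient u z with hg
  have hX : (fun y => if gradient u y = 0 then 0 else
      ‖gradient u y‖ ^ (p - 2) • gradient u y) =
      fun y => ‖gradient u y‖ ^ (p - 2) • gradient u y := by
    funext y
    split_ifs with h
    · simp [h]
    · rfl
  have hF := (hasFDerivAt_norm_rpow_smul (sub_nonneg.2 hp) (gradient u z)).comp z hA
  rw [← hg] at hF
  have hFi := fun i : Fin m => (EuclideanSpace.proj (𝕜 := ℝ) i).hasFDerivAt.comp z hF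
  have hsum : inner ℝ (A g) g = ∑ i, g i * inner ℝ g (A (EuclideanSpace.single i 1)) := by
    have h1 : g = ∑ i, g i • EuclideanSpace.single i (1 : ℝ) := by
      have := (EuclideanSpace.basisFun (Fin m) ℝ).sum_repr g
      simpa using this.symm
    have h2 : A g = ∑ i, g i • A (EuclideanSpace.single i (1 : ℝ)) := by
      conv_lhs => rw [h1]
      simp
    rw [real_inner_comm, h2, inner_sum]
    simp [inner_smul_right]
  rw [pLaplacian, hX, euclideanDiv, hsum, Finset.mul_sum, Finset.mul_sum,
    ← Finset.sum_add_distrib]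
  refine Finset.sum_congr rfl fun i _ => ?_
  have h3 : fderiv ℝ (fun y => (‖gradient u y‖ ^ (p - 2) • gradient u y) i) z = _ :=
    (hFi i).fderiv
  rw [h3]
  simp [EuclideanSpace.inner_single_right]
  ring

theorem hasFDerivAt_gradient {m : ℕ} {u : EuclideanSpace ℝ (Fin m) → ℝ} (hu : ContDiff ℝ 2 u)
    (z : EuclideanSpace ℝ (Fin m)) :
    HasFDerivAt (gradient u) (fderiv ℝ (gradient u) z) z := by
  have h1 : ContDiff ℝ 1 (fderiv ℝ u) := hu.fderiv_right (by norm_num)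
  have h2 : ContDiff ℝ 1 (gradient u) :=
    ((InnerProductSpace.toDual ℝ (EuclideanSpace ℝ (Fin m))).symm.contDiff).comp h1
  exact (h2.differentiable (by norm_num) z).hasFDerivAt

theorem hasDerivAt_along_line {m : ℕ} {u : EuclideanSpace ℝ (Fin m) → ℝ} (hu : ContDiff ℝ 2 u)
    (z h : EuclideanSpace ℝ (Fin m)) (t : ℝ) :
    HasDerivAt (fun t : ℝ => u (z + t • h)) (inner ℝ (gradient u (z + t • h)) h) t := by
  have h1 : HasDerivAt (fun t : ℝ => z + t • h) h t := by
    simpa using ((hasDerivAt_id t).smul_const h).const_add z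
  rw [inner_gradient_left]
  exact ((hu.differentiable (by norm_num) _).hasFDerivAt).comp_hasDerivAt t h1

theorem hasDerivAt_inner_gradient_along_line {m : ℕ} {u : EuclideanSpace ℝ (Fin m) → ℝ}
    (hu : ContDiff ℝ 2 u) (z h : EuclideanSpace ℝ (Fin m)) :
    HasDerivAt (fun t : ℝ => inner ℝ (gradient u (z + t • h)) h)
      (inner ℝ (fderiv ℝ (gradient u) z h) h) 0 := by
  have h1 : HasDerivAt (fun t : ℝ => z + t • h) h 0 := by
    simpa using ((hasDerivAt_id (0 : ℝ)).smul_const h).const_add z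
  have h0 := hasFDerivAt_gradient hu (z + (0 : ℝ) • h)
  have h2 := h0.comp_hasDerivAt 0 h1
  have h3 := h2.inner ℝ (hasDerivAt_const (0 : ℝ) h)
  simpa using h3

theorem gradient_bound_of_touching {m : ℕ} {u : EuclideanSpace ℝ (Fin m) → ℝ}
    (hu : ContDiff ℝ 2 u) {x₀ z : EuclideanSpace ℝ (Fin m)} {R α N L : ℝ} (hR : 0 < R)
    (hα : 0 < α) (hN : 0 < N) (hz : ‖z - x₀‖ < R)
    (huz : u z = L + N * (1 - ‖z - x₀‖ ^ 2 / R ^ 2) ^ (-α))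
    (hle : ∀ x, ‖x - x₀‖ < R → u x ≤ L + N * (1 - ‖x - x₀‖ ^ 2 / R ^ 2) ^ (-α)) :
    ‖gradient u z‖ ≤ 2 * α * N * (1 - ‖z - x₀‖ ^ 2 / R ^ 2) ^ (-α - 1) / R ∧
      ∀ h, inner ℝ (fderiv ℝ (gradient u) z h) h ≤
        (4 * α * (α + 1) + 2 * α) * N * (1 - ‖z - x₀‖ ^ 2 / R ^ 2) ^ (-α - 2) / R ^ 2
          * ‖h‖ ^ 2 := by
  set s := 1 - ‖z - x₀‖ ^ 2 / R ^ 2 with hs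
  have hspos : 0 < s := by
    rw [hs, sub_pos, div_lt_one (by positivity)]
    gcongr
  have hs1 : s ≤ 1 := by
    rw [hs]; linarith [show 0 ≤ ‖z - x₀‖ ^ 2 / R ^ 2 by positivity]
  let S : EuclideanSpace ℝ (Fin m) → ℝ → ℝ := fun h t =>
    1 - (‖z - x₀‖ ^ 2 + 2 * inner ℝ (z - x₀) h * t + ‖h‖ ^ 2 * t ^ 2) / R ^ 2
  let S' : EuclideanSpace ℝ (Fin m) → ℝ → ℝ := fun h t =>
    - (2 * inner ℝ (z - x₀) h + 2 * ‖h‖ ^ 2 * t) / R ^ 2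
  have hS0 : ∀ h, S h 0 = s := fun h => by simp [S, hs]
  have hSnorm : ∀ h t, 1 - ‖z + t • h - x₀‖ ^ 2 / R ^ 2 = S h t := fun h t => by
    have : z + t • h - x₀ = (z - x₀) + t • h := by abel
    rw [this, norm_add_sq_real, norm_smul, inner_smul_right, mul_pow, Real.norm_eq_abs, sq_abs]
    simp only [S]
    ring
  have hS : ∀ h t, HasDerivAt (S h) (S' h t) t := fun h t => by
    have h1 := ((((hasDerivAt_id t).const_mul (2 * inner ℝ (z - x₀) h)).const_add
      (‖z - x₀‖ ^ 2)).add (((hasDerivAt_id t).pow 2).const_mul (‖h‖ ^ 2))).div_const (R ^ 2)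
      |>.const_sub 1
    refine h1.congr_deriv ?_
    simp only [S', id]
    push_cast
    ring
  have hS' : ∀ h, HasDerivAt (S' h) (- (2 * ‖h‖ ^ 2) / R ^ 2) 0 := fun h => by
    have h1 := (((hasDerivAt_id (0 : ℝ)).const_mul (2 * ‖h‖ ^ 2)).const_add
      (2 * inner ℝ (z - x₀) h)).neg.div_const (R ^ 2)
    refine h1.congr_deriv ?_
    ring
  have hSev : ∀ h, ∀ᶠ t in nhds 0, 0 < S h t := fun h => by
    have := (hS h 0).continuousAt
    exact this.eventually (lt_mem_nhds (by rwa [hS0]))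
  let φ : EuclideanSpace ℝ (Fin m) → ℝ → ℝ := fun h t => u (z + t • h) - N * (S h t) ^ (-α)
  let φ' : EuclideanSpace ℝ (Fin m) → ℝ → ℝ := fun h t =>
    inner ℝ (gradient u (z + t • h)) h - N * (S' h t * (-α) * (S h t) ^ (-α - 1))
  have hmax : ∀ h, IsLocalMax (φ h) 0 := fun h => by
    filter_upwards [hSev h] with t ht
    have h1 : ‖z + t • h - x₀‖ < R := by
      rw [← hSnorm, sub_pos, div_lt_one (by positivity)] at ht
      exact lt_of_pow_lt_pow_left₀ 2 hR.le ht
    have h2 := hle _ h1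
    rw [hSnorm] at h2
    simp only [φ, hS0, zero_smul, add_zero]
    linarith
  have hφ : ∀ h, ∀ᶠ t in nhds 0, HasDerivAt (φ h) (φ' h t) t := fun h => by
    filter_upwards [hSev h] with t ht
    exact (hasDerivAt_along_line hu z h t).sub
      (((hS h t).rpow_const (p := -α) (Or.inl ht.ne')).const_mul N)
  have hφ' : ∀ h, HasDerivAt (φ' h) (inner ℝ (fderiv ℝ (gradient u) z h) h -
      N * (- (2 * ‖h‖ ^ 2) / R ^ 2 * (-α) * s ^ (-α - 1)
        + S' h 0 * (-α) * (S' h 0 * (-α - 1) * s ^ (-α - 1 - 1)))) 0 := fun h => by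
    have h1 := (hS h 0).rpow_const (p := -α - 1) (Or.inl (by rw [hS0]; exact hspos.ne'))
    have h2 := (hasDerivAt_inner_gradient_along_line hu z h).sub
      ((((hS' h).mul_const (-α)).mul h1).const_mul N)
    simp only [hS0] at h2
    exact h2
  have hinner : ∀ h, |inner ℝ (z - x₀) h| ≤ R * ‖h‖ := fun h =>
    (abs_real_inner_le_norm _ _).trans (by gcongr)
  constructor
  · set g := gradient u z with hg
    have h1 := (hmax g).hasDerivAt_eq_zero (hφ g).self_of_nhds
    simp only [φ', S', hS0, zero_smul, add_zero, mul_zero, ← hg, real_inner_self_eq_norm_sq] at h1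
    have h2 : ‖g‖ ^ 2 ≤ 2 * α * N * s ^ (-α - 1) / R * ‖g‖ := by
      have h3 : ‖g‖ ^ 2 = 2 * α * N * s ^ (-α - 1) / R ^ 2 * inner ℝ (z - x₀) g := by
        linear_combination h1
      rw [h3]
      calc _ ≤ 2 * α * N * s ^ (-α - 1) / R ^ 2 * (R * ‖g‖) := by
            gcongr
            exact (le_abs_self _).trans (hinner g)
        _ = _ := by field_simp
    rcases (norm_nonneg g).eq_or_lt with h0 | h0
    · rw [← h0]; positivity
    · rw [sq] at h2
      exact le_of_mul_le_mul_right h2 h0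
  · intro h
    have h1 := (hmax h).second_derivative_nonpos (hφ h) (hφ' h)
    simp only [S', mul_zero, add_zero] at h1
    have h2 : inner ℝ (fderiv ℝ (gradient u) z h) h ≤
        2 * α * N * s ^ (-α - 1) / R ^ 2 * ‖h‖ ^ 2
        + 4 * α * (α + 1) * N * s ^ (-α - 2) / R ^ 4 * (inner ℝ (z - x₀) h) ^ 2 := by
      rw [show -α - 1 - 1 = -α - 2 by ring] at h1
      have hR4 : (R ^ 4)⁻¹ = (R ^ 2)⁻¹ * (R ^ 2)⁻¹ := by rw [← mul_inv]; ring
      simp only [div_eq_mul_inv, hR4] at h1 ⊢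
      linarith
    have h3 : (inner ℝ (z - x₀) h) ^ 2 ≤ (R * ‖h‖) ^ 2 := by
      rw [← sq_abs]
      gcongr
      exact hinner h
    have h4 : s ^ (-α - 1) ≤ s ^ (-α - 2) :=
      Real.rpow_le_rpow_of_exponent_ge hspos hs1 (by linarith)
    calc _ ≤ _ := h2
      _ ≤ 2 * α * N * s ^ (-α - 2) / R ^ 2 * ‖h‖ ^ 2
        + 4 * α * (α + 1) * N * s ^ (-α - 2) / R ^ 4 * (R * ‖h‖) ^ 2 := by gcongr
      _ = _ := by field_simp; ring

theorem pLaplacian_le_of_touching {m : ℕ} {p : ℝ} (hp : 2 ≤ p)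
    {u : EuclideanSpace ℝ (Fin m) → ℝ}
    (hu : ContDiff ℝ 2 u) {x₀ z : EuclideanSpace ℝ (Fin m)} {R α N L : ℝ} (hR : 0 < R)
    (hα : 0 < α) (hN : 0 < N) (hz : ‖z - x₀‖ < R)
    (huz : u z = L + N * (1 - ‖z - x₀‖ ^ 2 / R ^ 2) ^ (-α))
    (hle : ∀ x, ‖x - x₀‖ < R → u x ≤ L + N * (1 - ‖x - x₀‖ ^ 2 / R ^ 2) ^ (-α)) :
    pLaplacian p u z ≤ (2 * α) ^ (p - 2) * (m + p - 2) * (4 * α * (α + 1) + 2 * α) *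
      N ^ (p - 1) * (1 - ‖z - x₀‖ ^ 2 / R ^ 2) ^ (-α * (p - 1) - p) / R ^ p := by
  obtain ⟨hg, hA⟩ := gradient_bound_of_touching hu hR hα hN hz huz hle
  set s := 1 - ‖z - x₀‖ ^ 2 / R ^ 2 with hs
  have hspos : 0 < s := by
    rw [hs, sub_pos, div_lt_one (by positivity)]
    gcongr
  set G := 2 * α * N * s ^ (-α - 1) / R with hG
  set M := (4 * α * (α + 1) + 2 * α) * N * s ^ (-α - 2) / R ^ 2 with hM
  have hM0 : 0 ≤ M := by positivity
  have hp2 : 0 ≤ p - 2 := sub_nonneg.2 hp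
  set g := gradient u z
  have h1 : ∑ i, inner ℝ (fderiv ℝ (gradient u) z (EuclideanSpace.single i 1))
      (EuclideanSpace.single i 1) ≤ m * M := by
    calc _ ≤ ∑ i : Fin m, M := Finset.sum_le_sum fun i _ => by
          simpa using hA (EuclideanSpace.single i 1)
      _ = _ := by simp
  have h2 : (p - 2) * ‖g‖ ^ (p - 2 - 2) * inner ℝ (fderiv ℝ (gradient u) z g) g ≤
      (p - 2) * ‖g‖ ^ (p - 2) * M := by
    rcases eq_or_ne g 0 with h0 | h0
    · rw [h0]
      simp only [map_zero, inner_zero_left, mul_zero]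
      positivity
    · have h3 : 0 < ‖g‖ := norm_pos_iff.2 h0
      have h4 : ‖g‖ ^ (p - 2 - 2) * ‖g‖ ^ 2 = ‖g‖ ^ (p - 2) := by
        rw [← Real.rpow_natCast, ← Real.rpow_add h3]; congr 1; push_cast; ring
      calc _ ≤ (p - 2) * ‖g‖ ^ (p - 2 - 2) * (M * ‖g‖ ^ 2) := by gcongr; exact hA g
        _ = (p - 2) * (‖g‖ ^ (p - 2 - 2) * ‖g‖ ^ 2) * M := by ring
        _ = _ := by rw [h4]
  rw [pLaplacian_eq hp (hasFDerivAt_gradient hu z)]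
  calc _ ≤ ‖g‖ ^ (p - 2) * (m * M) + (p - 2) * ‖g‖ ^ (p - 2) * M := by gcongr
    _ = ‖g‖ ^ (p - 2) * ((m + (p - 2)) * M) := by ring
    _ ≤ G ^ (p - 2) * ((m + (p - 2)) * M) := by gcongr
    _ = _ := by
      have e1 : N ^ (p - 1) = N ^ (p - 2) * N := by
        rw [← Real.rpow_add_one hN.ne']; congr 1; ring
      have e2 : s ^ (-α * (p - 1) - p) = s ^ ((-α - 1) * (p - 2)) * s ^ (-α - 2) := by
        rw [← Real.rpow_add hspos]; congr 1; ring
      have e3 : R ^ p = R ^ (p - 2) * R ^ 2 := by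
        rw [← Real.rpow_natCast, ← Real.rpow_add hR]; congr 1; push_cast; ring
      rw [hG, Real.div_rpow (by positivity) hR.le, Real.mul_rpow (by positivity) (by positivity),
        Real.mul_rpow (by positivity) hN.le, ← Real.rpow_mul hspos.le, hM, e1, e2, e3]
      field_simp
      ring

theorem exists_touching {E : Type*} [NormedAddCommGroup E] [ProperSpace E] {u : E → ℝ}
    (hu : Continuous u) {x₀ : E} {R α L : ℝ} (hR : 0 < R) (hα : 0 < α) (hx₀ : L < u x₀) :
    ∃ z N, u x₀ - L ≤ N ∧ ‖z - x₀‖ < R ∧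
      u z = L + N * (1 - ‖z - x₀‖ ^ 2 / R ^ 2) ^ (-α) ∧
      ∀ x, ‖x - x₀‖ < R → u x ≤ L + N * (1 - ‖x - x₀‖ ^ 2 / R ^ 2) ^ (-α) := by
  let W : E → ℝ := fun x => (u x - L) * (1 - ‖x - x₀‖ ^ 2 / R ^ 2) ^ α
  have hW : Continuous W := by
    refine (hu.sub continuous_const).mul (Continuous.rpow_const (by fun_prop) fun x => Or.inr hα.le)
  have hspos : ∀ x, ‖x - x₀‖ < R → 0 < 1 - ‖x - x₀‖ ^ 2 / R ^ 2 := fun x hx => by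
    rw [sub_pos, div_lt_one (by positivity)]
    gcongr
  obtain ⟨z, hz, hmax⟩ := (isCompact_closedBall x₀ R).exists_isMaxOn
    ⟨x₀, Metric.mem_closedBall_self hR.le⟩ hW.continuousOn
  have hWx₀ : W x₀ = u x₀ - L := by simp [W]
  have hN : u x₀ - L ≤ W z := hWx₀ ▸ hmax (Metric.mem_closedBall_self hR.le)
  have hzR : ‖z - x₀‖ < R := by
    rw [mem_closedBall_iff_norm] at hz
    refine hz.lt_of_ne fun h => ?_
    have : W z = 0 := by simp [W, h, hR.ne', Real.zero_rpow hα.ne']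
    linarith
  have hinv : ∀ x, ‖x - x₀‖ < R → u x = L + W x * (1 - ‖x - x₀‖ ^ 2 / R ^ 2) ^ (-α) :=
    fun x hx => by
      have h1 := hspos x hx
      simp only [W]
      rw [mul_assoc, ← Real.rpow_add h1]
      simp
  refine ⟨z, W z, hN, hzR, hinv z hzR, fun x hx => ?_⟩
  have h1 := hspos x hx
  rw [hinv x hx]
  have h2 : W x ≤ W z := hmax (mem_closedBall_iff_norm.2 hx.le)
  gcongr

theorem one_div_le_of_closedBall {m : ℕ} (hm : 2 ≤ m) {Q : ℝ → ℝ}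
    (hQpos : ∀ t > (0 : ℝ), 0 < Q t) (hQmono : ∀ s t : ℝ, 0 < s → s ≤ t → Q s ≤ Q t)
    {b : EuclideanSpace ℝ (Fin m) → ℝ} (hb : Continuous b)
    (hbQ : ∀ x : EuclideanSpace ℝ (Fin m), 0 < ‖x‖ → 1 / Q ‖x‖ ≤ b x)
    {r : ℝ} (hr : 0 < r) {x : EuclideanSpace ℝ (Fin m)} (hx : ‖x‖ ≤ r) : 1 / Q r ≤ b x := by
  have key : ∀ y : EuclideanSpace ℝ (Fin m), 0 < ‖y‖ → ‖y‖ ≤ r → 1 / Q r ≤ b y :=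
    fun y hy hyr => (one_div_le_one_div_of_le (hQpos _ hy) (hQmono _ _ hy hyr)).trans (hbQ y hy)
  rcases (norm_nonneg x).eq_or_lt with h0 | h0
  · have hx0 : x = 0 := norm_eq_zero.1 h0.symm
    subst hx0
    have : Nontrivial (EuclideanSpace ℝ (Fin m)) := by
      have : Nonempty (Fin m) := ⟨⟨0, by omega⟩⟩
      infer_instance
    have : (nhdsWithin (0 : EuclideanSpace ℝ (Fin m)) {0}ᶜ).NeBot :=
      Module.punctured_nhds_neBot ℝ _ 0
    refine ge_of_tendsto (hb.continuousAt.tendsto.mono_left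
      (nhdsWithin_le_nhds (a := 0) (s := {0}ᶜ))) ?_
    filter_upwards [self_mem_nhdsWithin,
      nhdsWithin_le_nhds (Metric.closedBall_mem_nhds 0 hr)] with y hy1 hy2
    exact key y (norm_pos_iff.2 hy1) (mem_closedBall_zero_iff.1 hy2)
  · exact key x h0 hx

theorem rpow_lower_bound {H σ v w a b : ℝ} (hσ : 1 < σ) (hw : 0 < w) (hvw : w ≤ v)
    (hwH : H ≤ w ^ (σ - 1)) (hb : 0 < b) (haH : max (-a) 0 / b ≤ H) :
    b * ((1 - H / w ^ (σ - 1)) * v ^ σ) ≤ b * v ^ σ + a * v := by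
  have hv : 0 < v := hw.trans_le hvw
  have hwp : 0 < w ^ (σ - 1) := by positivity
  rw [div_le_iff₀ hb] at haH
  have ha : -(H * b) ≤ a := by linarith [le_max_left (-a) 0]
  have hH : 0 ≤ H := by
    by_contra! h
    nlinarith [le_max_right (-a) 0]
  have h1 : w ^ (σ - 1) ≤ v ^ (σ - 1) := by gcongr
  have h2 : v ^ σ = v ^ (σ - 1) * v := by
    rw [← Real.rpow_add_one hv.ne']; congr 1; ring
  have h3 : v * (H * b) ≤ b * (H / w ^ (σ - 1) * v ^ σ) := by
    rw [h2]
    calc v * (H * b) = b * (H / w ^ (σ - 1) * (w ^ (σ - 1) * v)) := by field_simp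
      _ ≤ _ := by gcongr
  nlinarith [mul_le_mul_of_nonneg_right ha hv.le]

theorem stmt10 {m : ℕ} (hm : 2 ≤ m) (p σ H : ℝ) (hp : 2 ≤ p)
    (hσp : p - 1 < σ) (hσ : 1 < σ) (hH : 0 < H)
    (Q : ℝ → ℝ)
    (hQpos : ∀ t > (0:ℝ), 0 < Q t)
    (hQmono : ∀ s t : ℝ, 0 < s → s ≤ t → Q s ≤ Q t)
    (hQo : Q =o[atTop] fun t => t ^ p)
    (hliminf : ∃ C : ℝ, ∃ᶠ r in atTop, Q r * Real.log r / r ^ p ≤ C)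
    (a b : EuclideanSpace ℝ (Fin m) → ℝ) (ha : Continuous a) (hb : Continuous b)
    (hbQ : ∀ x : EuclideanSpace ℝ (Fin m), 0 < ‖x‖ → 1 / Q ‖x‖ ≤ b x)
    (haminus : ∃ C : ℝ, ∀ x, max (-a x) 0 ≤ C)
    (haH : ∀ x, max (-a x) 0 / b x ≤ H)
    (u : EuclideanSpace ℝ (Fin m) → ℝ) (hu : ContDiff ℝ 2 u)
    (hupos : ∀ x, 0 ≤ u x)
    (hineq : ∀ x, b x * u x ^ σ + a x * u x ≤ pLaplacian p u x) :
    ∀ x, u x ≤ H ^ (1 / (σ - 1)) := by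
  by_contra! hcon
  obtain ⟨x₀, hx₀⟩ := hcon
  set L := H ^ (1 / (σ - 1)) with hL
  have hσ1 : 0 < σ - 1 := sub_pos.2 hσ
  have hLpos : 0 < L := by positivity
  have hLH : L ^ (σ - 1) = H := by
    rw [hL, ← Real.rpow_mul hH.le, one_div_mul_cancel hσ1.ne', Real.rpow_one]
  set η := u x₀ - L with hη
  have hη0 : 0 < η := sub_pos.2 hx₀
  have hd : 0 < σ - (p - 1) := sub_pos.2 hσp
  set α := p / (σ - (p - 1)) with hα
  have hp0 : 0 < p := by linarith
  have hα0 : 0 < α := by positivity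
  set c := 1 - H / (L + η) ^ (σ - 1) with hc
  have hLη : H < (L + η) ^ (σ - 1) := by
    rw [← hLH]
    exact Real.rpow_lt_rpow hLpos.le (by linarith) hσ1
  have hc0 : 0 < c := by
    rw [hc, sub_pos, div_lt_one (by positivity)]
    exact hLη
  set K := (2 * α) ^ (p - 2) * (m + p - 2) * (4 * α * (α + 1) + 2 * α) with hK
  have hm' : (2 : ℝ) ≤ m := by exact_mod_cast hm
  have hK0 : 0 < K := by
    have : 0 < (m : ℝ) + p - 2 := by linarith
    positivity
  set ε := c * η ^ (σ - (p - 1)) / (K * 2 ^ p * 2) with hε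
  have hε0 : 0 < ε := by positivity
  obtain ⟨R, ⟨hRx, hR1⟩, hRQ⟩ := (((eventually_ge_atTop ‖x₀‖).and (eventually_ge_atTop 1)).and
    ((tendsto_id.const_mul_atTop (two_pos : (0 : ℝ) < 2)).eventually (hQo.def hε0))).exists
  have hR : 0 < R := by linarith
  have h2R : 0 < 2 * R := by linarith
  simp only [id] at hRQ
  rw [Real.norm_of_nonneg (hQpos _ h2R).le, Real.norm_of_nonneg (by positivity),
    Real.mul_rpow two_pos.le hR.le] at hRQ
  obtain ⟨z, N, hηN, hzR, huz, hle⟩ := exists_touching hu.continuous hR hα0 hx₀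
  have hN : 0 < N := hη0.trans_le hηN
  have hupper := pLaplacian_le_of_touching hp hu hR hα0 hN hzR huz hle
  rw [← hK] at hupper
  set s := 1 - ‖z - x₀‖ ^ 2 / R ^ 2 with hs
  have hspos : 0 < s := by
    rw [hs, sub_pos, div_lt_one (by positivity)]
    gcongr
  have hs1 : s ≤ 1 := by
    rw [hs]; linarith [show 0 ≤ ‖z - x₀‖ ^ 2 / R ^ 2 by positivity]
  have hz2R : ‖z‖ ≤ 2 * R := by
    have := norm_add_le (z - x₀) x₀
    rw [sub_add_cancel] at this
    linarith
  have hbz := one_div_le_of_closedBall hm hQpos hQmono hb hbQ h2R hz2R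
  have hQ0 := hQpos _ h2R
  have hbpos : 0 < b z := (one_div_pos.2 hQ0).trans_le hbz
  have hs1' : 1 ≤ s ^ (-α) := Real.one_le_rpow_of_pos_of_le_one_of_nonpos hspos hs1 (by linarith)
  have huz1 : L + η ≤ u z := by
    rw [huz]
    nlinarith
  have hlower := (rpow_lower_bound hσ (by linarith) huz1 hLη.le hbpos (haH z)).trans
    ((hineq z).trans hupper)
  rw [← hc] at hlower
  have hexp : -α * (p - 1) - p = -α * σ := by
    have : α * (σ - (p - 1)) = p := div_mul_cancel₀ _ hd.ne'
    linarith
  have huσ : N ^ σ * s ^ (-α * σ) ≤ u z ^ σ := by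
    rw [Real.rpow_mul hspos.le, ← Real.mul_rpow hN.le (by positivity)]
    gcongr
    rw [huz]; linarith
  have hNσ : N ^ σ = N ^ (σ - (p - 1)) * N ^ (p - 1) := by
    rw [← Real.rpow_add hN]; congr 1; ring
  have h1 : 1 / Q (2 * R) * (c * (η ^ (σ - (p - 1)) * N ^ (p - 1) * s ^ (-α * σ))) ≤
      K * N ^ (p - 1) * s ^ (-α * σ) / R ^ p := by
    rw [← hexp]
    refine le_trans ?_ hlower
    rw [hexp]
    gcongr
    refine le_trans ?_ huσ
    rw [hNσ]
    gcongr
  have h2 : c * η ^ (σ - (p - 1)) * R ^ p ≤ K * Q (2 * R) := by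
    have h3 : 0 < N ^ (p - 1) * s ^ (-α * σ) := by positivity
    rw [one_div, inv_mul_le_iff₀ hQ0, mul_div_assoc', le_div_iff₀ (by positivity)] at h1
    refine le_of_mul_le_mul_right ?_ h3
    linarith
  have h4 : K * Q (2 * R) ≤ c * η ^ (σ - (p - 1)) * R ^ p / 2 := by
    calc _ ≤ K * (ε * (2 ^ p * R ^ p)) := by gcongr
      _ = _ := by rw [hε]; field_simp
  have h5 : 0 < c * η ^ (σ - (p - 1)) * R ^ p := by positivity
  linarith
end
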